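/- Let R be a Cohen–Macaulay local ring with canonical module ω, and M a finitely generated R-module. Then M is maximal Cohen–Macaulay if and only if Tr M ⊗_R ω is maximal Cohen–Macaulay. -/

import Mathlib

open CategoryTheory TensorProduct IsLocalRing

noncomputable section

/-- The `n`-th Ext group of two `R`-modules. -/
abbrev extGroup (R : Type) [CommRing R] (n : ℕ) (M N : Type) [AddCommGroup M] [Module R M]
    [AddCommGroup N] [Module R N] : Type :=
  ((Ext R (ModuleCat R) n).obj (Opposite.op (ModuleCat.of R M))).obj (ModuleCat.of R N)

/-- The `n`-th Tor group of two `R`-modules. -/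
abbrev torGroup (R : Type) [CommRing R] (n : ℕ) (M N : Type) [AddCommGroup M] [Module R M]
    [AddCommGroup N] [Module R N] : Type :=
  ((Tor (ModuleCat R) n).obj (ModuleCat.of R M)).obj (ModuleCat.of R N)

/-- The depth of a module over a local ring, as the infimum of the degrees in which
`Ext(k, N)` is nonzero. -/
def moduleDepth (R : Type) [CommRing R] [IsLocalRing R] (N : Type) [AddCommGroup N]
    [Module R N] : ℕ∞ :=
  sInf {n : ℕ∞ | ∃ k : ℕ, n = k ∧
    Nontrivial (extGroup R k (R ⧸ IsLocalRing.maximalIdeal R) N)}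

/-- A module is maximal Cohen–Macaulay if `depth M_p = dim R_p` for all `p` in the support. -/
def IsMCM (R : Type) [CommRing R] (M : Type) [AddCommGroup M] [Module R M] : Prop :=
  ∀ p : PrimeSpectrum R, Nontrivial (LocalizedModule p.asIdeal.primeCompl M) →
    (moduleDepth (Localization.AtPrime p.asIdeal)
        (LocalizedModule p.asIdeal.primeCompl M) : WithBot ℕ∞) =
      ringKrullDim (Localization.AtPrime p.asIdeal)

/-- A local ring is Cohen–Macaulay if its depth equals its Krull dimension. -/
def IsCMLocal (R : Type) [CommRing R] [IsLocalRing R] : Prop :=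
  (moduleDepth R R : WithBot ℕ∞) = ringKrullDim R

/-- Injective dimension at most `n`, defined recursively via cosyzygies. -/
def hasInjDimLE (R : Type) [CommRing R] : ℕ → ∀ (M : Type) [AddCommGroup M] [Module R M], Prop
  | 0, M, _, _ => Module.Injective R M
  | (n+1), M, _, _ => ∃ (I : Type) (_ : AddCommGroup I) (_ : Module R I) (f : M →ₗ[R] I),
      Module.Injective R I ∧ Function.Injective f ∧
        hasInjDimLE R n (I ⧸ LinearMap.range f)

/-- Projective dimension at most `n`, defined recursively via syzygies. -/
def hasPdLE (R : Type) [CommRing R] : ℕ → ∀ (M : Type) [AddCommGroup M] [Module R M], Prop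
  | 0, M, _, _ => Module.Projective R M
  | (n+1), M, _, _ => ∃ (P : Type) (_ : AddCommGroup P) (_ : Module R P) (f : P →ₗ[R] M),
      Module.Projective R P ∧ Function.Surjective f ∧ hasPdLE R n (LinearMap.ker f)

/-- `ω` is a canonical module of the Cohen–Macaulay local ring `R`: it is finitely generated,
maximal Cohen–Macaulay, of finite injective dimension, and of type one. -/
def IsCanonicalModule (R : Type) [CommRing R] [IsLocalRing R] (ω : Type) [AddCommGroup ω]
    [Module R ω] : Prop :=
  Module.Finite R ω ∧ IsMCM R ω ∧ (∃ n, hasInjDimLE R n ω) ∧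
    ∃ d : ℕ, ringKrullDim R = d ∧
      Nonempty (extGroup R d (R ⧸ IsLocalRing.maximalIdeal R) ω ≃ₗ[R]
        (R ⧸ IsLocalRing.maximalIdeal R))

/-- `T` is an Auslander transpose of `M`: the cokernel of the `R`-dual of a minimal
free presentation of `M`. -/
def IsAuslanderTranspose (R : Type) [CommRing R] [IsLocalRing R] (M T : Type)
    [AddCommGroup M] [Module R M] [AddCommGroup T] [Module R T] : Prop :=
  ∃ (m n : ℕ) (f : (Fin n → R) →ₗ[R] (Fin m → R)),
    LinearMap.range f ≤ (IsLocalRing.maximalIdeal R) • (⊤ : Submodule R (Fin m → R)) ∧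
    LinearMap.ker f ≤ (IsLocalRing.maximalIdeal R) • (⊤ : Submodule R (Fin n → R)) ∧
    Nonempty (((Fin m → R) ⧸ LinearMap.range f) ≃ₗ[R] M) ∧
    Nonempty ((Module.Dual R (Fin n → R) ⧸ LinearMap.range f.dualMap) ≃ₗ[R] T)

end

open scoped Pointwise

section ExtComparison

variable {R : Type} [CommRing R]

open Abelian

theorem extMk_zero_eq_zero_iff {X Y : ModuleCat.{0} R} (P : ProjectiveResolution X)
    (f : P.complex.X 0 ⟶ Y) (hf : P.complex.d 1 0 ≫ f = 0) :
    P.extMk f 1 rfl hf = 0 ↔ f = 0 := by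
  refine ⟨fun h => ?_, ?_⟩
  · rw [← P.extEquivCohomologyClass.apply_eq_iff_eq, P.extEquivCohomologyClass_extMk,
      P.extEquivCohomologyClass_zero, CochainComplex.HomComplex.CohomologyClass.mk_eq_zero_iff,
      CochainComplex.HomComplex.Cocycle.toSingleMk_mem_coboundaries_iff _ _ _ _ _ 1 (by lia)] at h
    obtain ⟨g, hg⟩ := h
    have h0 : P.cochainComplex.d (-(0 : ℕ)) 1 = 0 :=
      (P.cochainComplex.isZero_of_isStrictlyLE 0 1 (by lia)).eq_of_tgt _ _
    rw [h0, Limits.zero_comp] at hg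
    exact (cancel_epi (P.cochainComplexXIso (-(0 : ℕ)) 0 (by simp)).hom).1 (by simpa using hg.symm)
  · rintro rfl
    simp

theorem extMk_eq_zero_iff_exists_prev {X Y : ModuleCat.{0} R} (P : ProjectiveResolution X)
    (n : ℕ) (f : P.complex.X n ⟶ Y) (hf : P.complex.d (n + 1) n ≫ f = 0) :
    P.extMk f (n + 1) rfl hf = 0 ↔
      ∃ g : P.complex.X (n - 1) ⟶ Y, P.complex.d n (n - 1) ≫ g = f := by
  cases n with
  | zero =>
    rw [extMk_zero_eq_zero_iff]
    simp [eq_comm]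
  | succ n => exact P.extMk_eq_zero_iff f _ rfl hf n rfl

/-- Taking the class of a cocycle in a projective resolution, as a linear map. -/
noncomputable def extMkLinear {X Y : ModuleCat.{0} R} (P : ProjectiveResolution X) (n : ℕ) :
    LinearMap.ker (Linear.leftComp R Y (P.complex.d (n + 1) n)) →ₗ[R] Ext X Y n where
  toFun f := P.extMk f.1 (n + 1) rfl (LinearMap.mem_ker.1 f.2)
  map_add' f g := (P.add_extMk _ _ _ _ (LinearMap.mem_ker.1 f.2) (LinearMap.mem_ker.1 g.2)).symm
  map_smul' r f := by
    rw [RingHom.id_apply, Ext.smul_eq_comp_mk₀,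
      P.extMk_comp_mk₀ f.1 (n + 1) rfl (LinearMap.mem_ker.1 f.2)]
    congr 1

/-- The derived functor `Ext` agrees with the `Ext` defined through the derived category. -/
theorem nonempty_extGroup_equiv (n : ℕ) (X Y : Type) [AddCommGroup X] [Module R X]
    [AddCommGroup Y] [Module R Y] :
    Nonempty (extGroup R n X Y ≃ₗ[R] Ext (ModuleCat.of R X) (ModuleCat.of R Y) n) := by
  let P := projectiveResolution (ModuleCat.of R X)
  let K := P.complex.linearYonedaObj R (ModuleCat.of R Y)
  let e₁ := P.isoExt (R := R) n (ModuleCat.of R Y)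
  let S := K.sc' (n - 1) n (n + 1)
  have hp : (ComplexShape.up ℕ).prev n = n - 1 := by cases n <;> simp
  let e₂ : K.homology n ≅ S.homology :=
    ShortComplex.homologyMapIso (K.isoSc' (n - 1) n (n + 1) hp (by simp))
  let e₃ := S.moduleCatHomologyIso
  let p : LinearMap.ker S.g.hom →ₗ[R] S.moduleCatLeftHomologyData.H :=
    S.moduleCatLeftHomologyData.π.hom
  let q : LinearMap.ker S.g.hom →ₗ[R] Ext (ModuleCat.of R X) (ModuleCat.of R Y) n :=
    extMkLinear P n
  have hp : Function.Surjective p := Submodule.mkQ_surjective _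
  have hq : Function.Surjective q := fun a => by
    obtain ⟨f, hf, rfl⟩ := P.extMk_surjective a (n + 1) rfl
    exact ⟨⟨f, hf⟩, rfl⟩
  have hpq : LinearMap.ker p = LinearMap.ker q := by
    ext ⟨f, hf⟩
    have : (⟨f, hf⟩ ∈ LinearMap.ker q) ↔ _ := extMk_eq_zero_iff_exists_prev P n f hf
    rw [this]
    have h2 : (⟨f, hf⟩ ∈ LinearMap.ker p) ↔
        (⟨f, hf⟩ : LinearMap.ker S.g.hom) ∈ LinearMap.range S.moduleCatToCycles :=
      Submodule.Quotient.mk_eq_zero _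
    rw [h2]
    constructor
    · rintro ⟨g, hg⟩
      exact ⟨g, congrArg Subtype.val hg⟩
    · rintro ⟨g, hg⟩
      exact ⟨g, Subtype.ext hg⟩
  exact ⟨(e₁ ≪≫ e₂ ≪≫ e₃).toLinearEquiv ≪≫ₗ (p.quotKerEquivOfSurjective hp).symm ≪≫ₗ
    Submodule.quotEquivOfEq _ _ hpq ≪≫ₗ q.quotKerEquivOfSurjective hq⟩

end ExtComparison

/-- Vanishing of the `n`-th Ext module of `X` and `Y`. -/
def ExtVanishes (R : Type) [CommRing R] (n : ℕ) (X Y : Type) [AddCommGroup X] [Module R X]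
    [AddCommGroup Y] [Module R Y] : Prop :=
  Subsingleton (Abelian.Ext (ModuleCat.of R X) (ModuleCat.of R Y) n)

namespace ExtVanishes

open Abelian

variable {R : Type} [CommRing R] {A B C X Y Z : Type} [AddCommGroup A] [Module R A]
  [AddCommGroup B] [Module R B] [AddCommGroup C] [Module R C] [AddCommGroup X] [Module R X]
  [AddCommGroup Y] [Module R Y] [AddCommGroup Z] [Module R Z] {n : ℕ}

theorem iff_extGroup : ExtVanishes R n X Y ↔ Subsingleton (extGroup R n X Y) := by
  obtain ⟨e⟩ := nonempty_extGroup_equiv (R := R) n X Y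
  exact e.toEquiv.symm.subsingleton_congr

theorem zero_iff : ExtVanishes R 0 X Y ↔ Subsingleton (X →ₗ[R] Y) :=
  (Ext.addEquiv₀.trans ModuleCat.homAddEquiv).toEquiv.subsingleton_congr

theorem iff_forall : ExtVanishes R n X Y ↔
    ∀ x : Ext (ModuleCat.of R X) (ModuleCat.of R Y) n, x = 0 :=
  ⟨fun h x => h.elim x 0, fun h => ⟨fun x y => (h x).trans (h y).symm⟩⟩

theorem of_projective [Module.Projective R X] : ExtVanishes R (n + 1) X Y := by
  have := (IsProjective.iff_projective (R := R) X).1 inferInstance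
  exact iff_forall.2 Ext.eq_zero_of_projective

theorem of_injective [Module.Injective R Y] : ExtVanishes R (n + 1) X Y := by
  have := (Module.injective_iff_injective_object R Y).1 inferInstance
  exact iff_forall.2 Ext.eq_zero_of_injective

theorem of_subsingleton_left [Subsingleton X] : ExtVanishes R n X Y := by
  have : Limits.IsZero (ModuleCat.of R X) := ModuleCat.isZero_of_subsingleton _
  refine iff_forall.2 fun x => ?_
  rw [← Ext.mk₀_id_comp x, this.eq_of_src (𝟙 _) 0, Ext.mk₀_zero, Ext.zero_comp]

theorem of_subsingleton_right [Subsingleton Y] : ExtVanishes R n X Y := by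
  have : Limits.IsZero (ModuleCat.of R Y) := ModuleCat.isZero_of_subsingleton _
  refine iff_forall.2 fun x => ?_
  rw [← Ext.comp_mk₀_id x, this.eq_of_src (𝟙 _) 0, Ext.mk₀_zero, Ext.comp_zero]

theorem congr_left (e : X ≃ₗ[R] Z) (h : ExtVanishes R n X Y) : ExtVanishes R n Z Y := by
  refine iff_forall.2 fun x => ?_
  have h1 := iff_forall.1 h ((Ext.mk₀ (ModuleCat.ofHom e.toLinearMap)).comp x (zero_add n))
  have h2 : (Ext.mk₀ (ModuleCat.ofHom e.symm.toLinearMap)).comp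
    ((Ext.mk₀ (ModuleCat.ofHom e.toLinearMap)).comp x (zero_add n)) (zero_add n) = x := by
    have : ModuleCat.ofHom e.symm.toLinearMap ≫ ModuleCat.ofHom e.toLinearMap = 𝟙 _ := by
      ext; simp
    rw [Ext.mk₀_comp_mk₀_assoc, this, Ext.mk₀_id_comp]
  rw [← h2, h1, Ext.comp_zero]

theorem congr_right (e : Y ≃ₗ[R] Z) (h : ExtVanishes R n X Y) : ExtVanishes R n X Z := by
  refine iff_forall.2 fun x => ?_
  have h1 := iff_forall.1 h (x.comp (Ext.mk₀ (ModuleCat.ofHom e.symm.toLinearMap)) (add_zero n))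
  have h2 : (x.comp (Ext.mk₀ (ModuleCat.ofHom e.symm.toLinearMap)) (add_zero n)).comp
    (Ext.mk₀ (ModuleCat.ofHom e.toLinearMap)) (add_zero n) = x := by
    have : ModuleCat.ofHom e.symm.toLinearMap ≫ ModuleCat.ofHom e.toLinearMap = 𝟙 _ := by
      ext; simp
    rw [Ext.comp_assoc_of_third_deg_zero, Ext.mk₀_comp_mk₀, this, Ext.comp_mk₀_id]
  rw [← h2, h1, Ext.zero_comp]

variable {f : A →ₗ[R] B} {g : B →ₗ[R] C}

theorem _root_.LinearMap.shortExact_of_exact (hf : Function.Injective f)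
    (hfg : Function.Exact f g) (hg : Function.Surjective g) :
    (ShortComplex.mk (ModuleCat.ofHom f) (ModuleCat.ofHom g)
      (by rw [← ModuleCat.ofHom_comp, hfg.linearMap_comp_eq_zero]; rfl)).ShortExact where
  exact := ModuleCat.shortComplex_exact _ hfg
  mono_f := (ModuleCat.mono_iff_injective _).2 hf
  epi_g := (ModuleCat.epi_iff_surjective _).2 hg

theorem middle_right (hf : Function.Injective f) (hfg : Function.Exact f g)
    (hg : Function.Surjective g) (hA : ExtVanishes R n X A) (hC : ExtVanishes R n X C) :
    ExtVanishes R n X B := by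
  refine iff_forall.2 fun x => ?_
  obtain ⟨y, rfl⟩ := Ext.covariant_sequence_exact₂ _ (LinearMap.shortExact_of_exact hf hfg hg) x
    (iff_forall.1 hC _)
  rw [iff_forall.1 hA y, Ext.zero_comp]

theorem sub_right (hf : Function.Injective f) (hfg : Function.Exact f g)
    (hg : Function.Surjective g) (hC : ExtVanishes R n X C) (hB : ExtVanishes R (n + 1) X B) :
    ExtVanishes R (n + 1) X A := by
  refine iff_forall.2 fun x => ?_
  obtain ⟨y, rfl⟩ := Ext.covariant_sequence_exact₁ _ (LinearMap.shortExact_of_exact hf hfg hg) x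
    (iff_forall.1 hB _) rfl
  rw [iff_forall.1 hC y, Ext.zero_comp]

theorem sub_right_zero (hf : Function.Injective f) (hB : ExtVanishes R 0 X B) :
    ExtVanishes R 0 X A := by
  rw [zero_iff] at *
  refine ⟨fun u v => ?_⟩
  ext x
  exact hf (LinearMap.congr_fun (hB.elim (f ∘ₗ u) (f ∘ₗ v)) x)

theorem quot_right (hf : Function.Injective f) (hfg : Function.Exact f g)
    (hg : Function.Surjective g) (hB : ExtVanishes R n X B) (hA : ExtVanishes R (n + 1) X A) :
    ExtVanishes R n X C := by
  refine iff_forall.2 fun x => ?_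
  obtain ⟨y, rfl⟩ := Ext.covariant_sequence_exact₃ _ (LinearMap.shortExact_of_exact hf hfg hg) x
    rfl (iff_forall.1 hA _)
  rw [iff_forall.1 hB y, Ext.zero_comp]

theorem middle_left (hf : Function.Injective f) (hfg : Function.Exact f g)
    (hg : Function.Surjective g) (hA : ExtVanishes R n A Y) (hC : ExtVanishes R n C Y) :
    ExtVanishes R n B Y := by
  refine iff_forall.2 fun x => ?_
  obtain ⟨y, rfl⟩ := Ext.contravariant_sequence_exact₂ (LinearMap.shortExact_of_exact hf hfg hg) _
    x (iff_forall.1 hA _)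
  rw [iff_forall.1 hC y, Ext.comp_zero]

theorem sub_left (hf : Function.Injective f) (hfg : Function.Exact f g)
    (hg : Function.Surjective g) (hB : ExtVanishes R n B Y) (hC : ExtVanishes R (n + 1) C Y) :
    ExtVanishes R n A Y := by
  refine iff_forall.2 fun x => ?_
  obtain ⟨y, rfl⟩ := Ext.contravariant_sequence_exact₁ (LinearMap.shortExact_of_exact hf hfg hg) _
    x (add_comm 1 n) (iff_forall.1 hC _)
  rw [iff_forall.1 hB y, Ext.comp_zero]

theorem quot_left (hf : Function.Injective f) (hfg : Function.Exact f g)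
    (hg : Function.Surjective g) (hA : ExtVanishes R n A Y) (hB : ExtVanishes R (n + 1) B Y) :
    ExtVanishes R (n + 1) C Y := by
  refine iff_forall.2 fun x => ?_
  obtain ⟨y, rfl⟩ := Ext.contravariant_sequence_exact₃ (LinearMap.shortExact_of_exact hf hfg hg) _
    x (iff_forall.1 hB _) (add_comm 1 n)
  rw [iff_forall.1 hA y, Ext.comp_zero]

/-- If multiplication by `x` is injective on `X` and `Extⁿ⁺¹` vanishes on the cokernel, then
`Extⁿ` vanishes on `X` by Nakayama. -/
theorem of_mul_injective [IsLocalRing R] [IsNoetherianRing R] [Module.Finite R X]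
    [Module.Finite R Y] {x : R} (hx : x ∈ maximalIdeal R) {g : X →ₗ[R] C}
    (hf : Function.Injective (LinearMap.lsmul R X x))
    (hfg : Function.Exact (LinearMap.lsmul R X x) g) (hg : Function.Surjective g)
    (hC : ExtVanishes R (n + 1) C Y) : ExtVanishes R n X Y := by
  have key : ∀ y : Ext (ModuleCat.of R X) (ModuleCat.of R Y) n, ∃ z, y = x • z := fun y => by
    obtain ⟨z, hz⟩ := Ext.contravariant_sequence_exact₁ (LinearMap.shortExact_of_exact hf hfg hg) _
      y (add_comm 1 n) (iff_forall.1 hC _)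
    refine ⟨z, hz.symm.trans ?_⟩
    have : ModuleCat.ofHom (LinearMap.lsmul R X x) = x • 𝟙 (ModuleCat.of R X) := rfl
    dsimp only
    rw [this, Ext.mk₀_smul, Ext.smul_comp, Ext.mk₀_id_comp]
  have htop : (⊤ : Submodule R (Ext (ModuleCat.of R X) (ModuleCat.of R Y) n)) = ⊥ := by
    refine Submodule.eq_bot_of_le_smul_of_le_jacobson_bot (Ideal.span {x}) _
      Module.Finite.fg_top (fun y _ => ?_) ?_
    · obtain ⟨z, rfl⟩ := key y
      exact Submodule.smul_mem_smul (Ideal.mem_span_singleton_self x) trivial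
    · rw [IsLocalRing.jacobson_eq_maximalIdeal ⊥ bot_ne_top, Ideal.span_singleton_le_iff_mem]
      exact hx
  exact iff_forall.2 fun y => by simpa using htop.le (Submodule.mem_top (x := y))

/-- If `x` kills `X` and is regular on `Y`, vanishing of Ext into `Y/xY` lifts. -/
theorem succ_of_mul_injective {x : R} (hx : x ∈ Module.annihilator R X)
    {g : Y →ₗ[R] C} (hf : Function.Injective (LinearMap.lsmul R Y x))
    (hfg : Function.Exact (LinearMap.lsmul R Y x) g) (hg : Function.Surjective g)
    (h : ExtVanishes R n X C) : ExtVanishes R (n + 1) X Y := by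
  refine iff_forall.2 fun y => ?_
  have hz := DFunLike.congr_fun (congrArg AddCommGrpCat.Hom.hom
    (Abelian.Ext.postcomp_smul_id_eq_zero_of_mem_annihilator (M := ModuleCat.of R Y)
    (N := ModuleCat.of R X) hx (n + 1))) y
  obtain ⟨z, rfl⟩ := Abelian.Ext.covariant_sequence_exact₁ _
    (LinearMap.shortExact_of_exact hf hfg hg) y hz rfl
  rw [iff_forall.1 h z, Abelian.Ext.zero_comp]

end ExtVanishes

section Depth

variable (R : Type) [CommRing R] [IsLocalRing R]

/-- The depth of `X` is at least `n`, in terms of vanishing of Ext modules. -/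
def DepthGE (n : ℕ) (X : Type) [AddCommGroup X] [Module R X] : Prop :=
  ∀ i < n, ExtVanishes R i (R ⧸ maximalIdeal R) X

variable {R} {A B C X Y : Type} [AddCommGroup A] [Module R A]
  [AddCommGroup B] [Module R B] [AddCommGroup C] [Module R C] [AddCommGroup X] [Module R X]
  [AddCommGroup Y] [Module R Y] {n : ℕ}

theorem le_moduleDepth_iff : (n : ℕ∞) ≤ moduleDepth R X ↔ DepthGE R n X := by
  simp only [moduleDepth, le_sInf_iff, Set.mem_ofPred_eq, forall_exists_index, and_imp, DepthGE,
    ExtVanishes.iff_extGroup]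
  constructor
  · intro h i hi
    by_contra hc
    rw [not_subsingleton_iff_nontrivial] at hc
    have := h i i rfl hc
    norm_cast at this
    lia
  · rintro h _ i rfl hc
    by_contra hi
    rw [not_le] at hi
    norm_cast at hi
    exact not_subsingleton_iff_nontrivial.2 hc (h i hi)

namespace DepthGE

theorem mono {m : ℕ} (hmn : m ≤ n) (h : DepthGE R n X) : DepthGE R m X :=
  fun i hi => h i (hi.trans_le hmn)

theorem zero : DepthGE R 0 X := fun i hi => by lia

theorem of_subsingleton [Subsingleton X] : DepthGE R n X :=
  fun _ _ => ExtVanishes.of_subsingleton_right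

theorem congr (e : X ≃ₗ[R] Y) (h : DepthGE R n X) : DepthGE R n Y :=
  fun i hi => (h i hi).congr_right e

section ShortExact

variable {f : A →ₗ[R] B} {g : B →ₗ[R] C}

theorem middle (hf : Function.Injective f) (hfg : Function.Exact f g)
    (hg : Function.Surjective g) (hA : DepthGE R n A) (hC : DepthGE R n C) : DepthGE R n B :=
  fun i hi => ExtVanishes.middle_right hf hfg hg (hA i hi) (hC i hi)

theorem sub_succ (hf : Function.Injective f) (hfg : Function.Exact f g)
    (hg : Function.Surjective g) (hB : DepthGE R (n + 1) B) (hC : DepthGE R n C) :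
    DepthGE R (n + 1) A := fun i hi => by
  cases i with
  | zero => exact (hB 0 hi).sub_right_zero hf
  | succ i => exact ExtVanishes.sub_right hf hfg hg (hC i (by lia)) (hB _ hi)

theorem sub (hf : Function.Injective f) (hfg : Function.Exact f g)
    (hg : Function.Surjective g) (hB : DepthGE R n B) (hC : DepthGE R n C) : DepthGE R n A := by
  cases n with
  | zero => exact zero
  | succ n => exact sub_succ hf hfg hg hB (hC.mono n.le_succ)

theorem quot (hf : Function.Injective f) (hfg : Function.Exact f g)
    (hg : Function.Surjective g) (hB : DepthGE R n B) (hA : DepthGE R (n + 1) A) :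
    DepthGE R n C :=
  fun i hi => ExtVanishes.quot_right hf hfg hg (hB i hi) (hA (i + 1) (by lia))

end ShortExact

theorem prod (hX : DepthGE R n X) (hY : DepthGE R n Y) : DepthGE R n (X × Y) :=
  middle (f := LinearMap.inl R X Y) (g := LinearMap.snd R X Y) LinearMap.inl_injective
    Function.Exact.inl_snd LinearMap.snd_surjective hX hY

theorem pi (hX : DepthGE R n X) (m : ℕ) : DepthGE R n (Fin m → X) := by
  induction m with
  | zero => exact of_subsingleton
  | succ m ih => exact (hX.prod ih).congr (Fin.consLinearEquiv R fun _ => X)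

end DepthGE

namespace DepthGE

theorem mem_annihilator_residue {x : R} (hx : x ∈ maximalIdeal R) :
    x ∈ Module.annihilator R (R ⧸ maximalIdeal R) := by
  rwa [Ideal.annihilator_quotient]

theorem of_mul_injective {x : R} (hx : x ∈ maximalIdeal R)
    {g : X →ₗ[R] C} (hf : Function.Injective (LinearMap.lsmul R X x))
    (hfg : Function.Exact (LinearMap.lsmul R X x) g) (hg : Function.Surjective g)
    (h : DepthGE R n C) : DepthGE R (n + 1) X := by
  intro i hi
  cases i with
  | zero =>
    rw [ExtVanishes.zero_iff]
    refine ⟨fun u v => ?_⟩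
    ext
    apply hf
    have hz : ∀ (w : R ⧸ maximalIdeal R →ₗ[R] X) (a : R ⧸ maximalIdeal R), x • w a = 0 :=
      fun w a => by
        rw [← map_smul, Module.mem_annihilator.1 (mem_annihilator_residue hx), map_zero]
    exact (hz u _).trans (hz v _).symm
  | succ i =>
    exact (h i (by lia)).succ_of_mul_injective (mem_annihilator_residue hx) hf hfg hg

theorem exists_isSMulRegular [IsNoetherianRing R] [Module.Finite R X]
    (h : DepthGE R (n + 1) X) : ∃ x ∈ maximalIdeal R, IsSMulRegular X x := by
  have := ExtVanishes.zero_iff.1 (h 0 (by lia))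
  rw [IsSMulRegular.subsingleton_linearMap_iff] at this
  simpa only [Ideal.annihilator_quotient] using this

theorem quotSMulTop {x : R} (hx : IsSMulRegular X x) (h : DepthGE R (n + 1) X) :
    DepthGE R n (QuotSMulTop x X) :=
  quot (f := LinearMap.lsmul R X x) hx (LinearMap.exact_lsmul_mkQ_smul_top X x)
    (Submodule.mkQ_surjective _) (h.mono n.le_succ) h

theorem exists_isRegular [IsNoetherianRing R] [Module.Finite R X] [Nontrivial X]
    (h : DepthGE R n X) : ∃ rs : List R, rs.length = n ∧ (∀ r ∈ rs, r ∈ maximalIdeal R) ∧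
      RingTheory.Sequence.IsRegular X rs := by
  refine ModuleCat.exists_isRegular_of_exists_subsingleton_ext (maximalIdeal R) n
    (ModuleCat.of R X) ?_ (ModuleCat.of R (R ⧸ maximalIdeal R)) ?_ h
  · rw [lt_top_iff_ne_top]
    intro hc
    exact Submodule.top_ne_ideal_smul_of_le_jacobson_annihilator
      (IsLocalRing.maximalIdeal_le_jacobson _) hc.symm
  · rw [Module.support_eq_zeroLocus, Ideal.annihilator_quotient]

theorem le_ringKrullDim [IsNoetherianRing R] [Module.Finite R X] [Nontrivial X]
    (h : DepthGE R n X) : (n : WithBot ℕ∞) ≤ ringKrullDim R := by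
  obtain ⟨rs, rfl, -, hrs⟩ := h.exists_isRegular
  have := Module.supportDim_add_length_eq_supportDim_of_isRegular rs hrs
  refine le_trans ?_ (this.le.trans (Module.supportDim_le_ringKrullDim R X))
  have : Nontrivial (X ⧸ Ideal.ofList rs • (⊤ : Submodule R X)) :=
    Submodule.Quotient.nontrivial_iff.2 hrs.2.symm
  obtain ⟨a, ha⟩ := WithBot.ne_bot_iff_exists.1
    (Module.supportDim_ne_bot_of_nontrivial R (X ⧸ Ideal.ofList rs • (⊤ : Submodule R X)))
  rw [← ha]
  exact_mod_cast le_add_self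

theorem moduleDepth_eq_iff [IsNoetherianRing R] [Module.Finite R X] [Nontrivial X] {d : ℕ}
    (hd : ringKrullDim R = d) :
    (moduleDepth R X : WithBot ℕ∞) = ringKrullDim R ↔ DepthGE R d X := by
  rw [← le_moduleDepth_iff, hd]
  refine ⟨fun h => (by exact_mod_cast h.ge), fun h => le_antisymm ?_ (by exact_mod_cast h)⟩
  by_contra hlt
  have hlt' : (d : ℕ∞) < moduleDepth R X := by exact_mod_cast not_le.1 hlt
  have h1 : DepthGE R (d + 1) X :=
    le_moduleDepth_iff.1 (by exact_mod_cast Order.add_one_le_of_lt hlt')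
  have h2 := h1.le_ringKrullDim
  rw [hd] at h2
  norm_cast at h2
  lia

end DepthGE

end Depth

theorem DepthGE.restrictScalars {R A : Type} [CommRing R] [IsLocalRing R]
    [CommRing A] [IsLocalRing A] [IsNoetherianRing A] [Algebra R A]
    [IsLocalization.AtPrime A (maximalIdeal R)] (n : ℕ) (Y : Type) [AddCommGroup Y] [Module R Y]
    [Module A Y] [IsScalarTower R A Y] [Module.Finite A Y] (h : DepthGE A n Y) :
    DepthGE R n Y := by
  induction n generalizing Y with
  | zero => exact zero
  | succ n ih =>
    obtain ⟨y, hy, hreg⟩ := h.exists_isSMulRegular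
    obtain ⟨r, s, rfl⟩ := IsLocalization.exists_mk'_eq (maximalIdeal R).primeCompl y
    have hmem : r ∈ maximalIdeal R := by
      by_contra hr
      exact (mem_nonunits_iff.1 ((mem_maximalIdeal _).1 hy))
        ((IsLocalization.AtPrime.isUnit_mk'_iff A (maximalIdeal R) r s).2 hr)
    have hreg' : IsSMulRegular Y (algebraMap R A r) := by
      rw [← IsLocalization.mk'_spec A r s]
      exact hreg.mul ((IsLocalization.map_units A s).isSMulRegular Y)
    have hinj : Function.Injective (LinearMap.lsmul R Y r) := fun a b hab => by
      apply hreg'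
      change r • a = r • b at hab
      simpa only [algebraMap_smul] using hab
    let g : Y →ₗ[R] QuotSMulTop (algebraMap R A r) Y :=
      (Submodule.mkQ ((algebraMap R A r) • (⊤ : Submodule A Y))).restrictScalars R
    have hex : Function.Exact (LinearMap.lsmul R Y r) g := by
      intro a
      refine (LinearMap.exact_lsmul_mkQ_smul_top Y (algebraMap R A r) a).trans ?_
      refine exists_congr fun b => ?_
      rw [LinearMap.lsmul_apply, LinearMap.lsmul_apply, algebraMap_smul]
    have hsurj : Function.Surjective g := Submodule.mkQ_surjective (algebraMap R A r • ⊤)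
    have hq : DepthGE R n (QuotSMulTop (algebraMap R A r) Y) := ih _ (h.quotSMulTop hreg')
    exact of_mul_injective hmem hinj hex hsurj hq

section MaximalCohenMacaulay

variable {R : Type} [CommRing R] [IsLocalRing R]

theorem IsLocalRing.bijective_mkLinearMap (X : Type) [AddCommGroup X] [Module R X] :
    Function.Bijective (LocalizedModule.mkLinearMap (maximalIdeal R).primeCompl X) := by
  have : IsLocalization (maximalIdeal R).primeCompl R :=
    IsLocalization.self fun x hx => by simpa [IsUnit.mem_submonoid_iff] using hx
  have : IsLocalizedModule (maximalIdeal R).primeCompl (LinearMap.id : X →ₗ[R] X) :=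
    isLocalizedModule_id _ X R
  have h := (IsLocalizedModule.linearEquiv (maximalIdeal R).primeCompl (LinearMap.id : X →ₗ[R] X)
    (LocalizedModule.mkLinearMap (maximalIdeal R).primeCompl X)).bijective
  convert h using 1
  ext x
  exact (IsLocalizedModule.linearEquiv_apply (maximalIdeal R).primeCompl
    (LinearMap.id : X →ₗ[R] X) _ x).symm

theorem IsMCM.depthGE [IsNoetherianRing R] {d : ℕ} (hd : ringKrullDim R = d) {X : Type}
    [AddCommGroup X] [Module R X] [Module.Finite R X] (h : IsMCM R X) : DepthGE R d X := by
  have hb := IsLocalRing.bijective_mkLinearMap (R := R) X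
  rcases subsingleton_or_nontrivial (LocalizedModule (maximalIdeal R).primeCompl X) with hs | hn
  · have : Subsingleton X := hb.1.subsingleton
    exact DepthGE.of_subsingleton
  · have h1 := h (closedPoint R) hn
    have hd' : ringKrullDim (Localization.AtPrime (closedPoint R).asIdeal) = d := by
      rw [IsLocalization.AtPrime.ringKrullDim_eq_height (closedPoint R).asIdeal, ← hd]
      exact IsLocalRing.maximalIdeal_height_eq_ringKrullDim
    have hn' : Nontrivial (LocalizedModule (closedPoint R).asIdeal.primeCompl X) := hn
    rw [DepthGE.moduleDepth_eq_iff hd'] at h1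
    have h2 := DepthGE.restrictScalars (R := R) (A := Localization.AtPrime (maximalIdeal R)) d
      (LocalizedModule (maximalIdeal R).primeCompl X) h1
    exact h2.congr (LinearEquiv.ofBijective _ hb).symm

end MaximalCohenMacaulay

section InjectiveDimension

variable {R : Type} [CommRing R]

theorem hasInjDimLE.extVanishes {n : ℕ} {Y : Type} [AddCommGroup Y] [Module R Y]
    (h : hasInjDimLE R n Y) {X : Type} [AddCommGroup X] [Module R X] {i : ℕ} (hi : n < i) :
    ExtVanishes R i X Y := by
  induction n generalizing Y i with
  | zero =>
    have : Module.Injective R Y := h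
    obtain ⟨i, rfl⟩ := Nat.exists_eq_succ_of_ne_zero hi.ne'
    exact ExtVanishes.of_injective
  | succ n ih =>
    obtain ⟨I, _, _, f, hI, hf, hq⟩ := h
    obtain ⟨i, rfl⟩ := Nat.exists_eq_succ_of_ne_zero (Nat.ne_zero_of_lt hi)
    exact ExtVanishes.sub_right hf (LinearMap.exact_map_mkQ_range f)
      (Submodule.mkQ_surjective _) (ih hq (by lia)) ExtVanishes.of_injective

end InjectiveDimension

section InjectiveDimensionBound

variable {R : Type} [CommRing R] [IsNoetherianRing R] [IsLocalRing R]

theorem exists_injective_residue_of_depthGE (n : ℕ) {e : ℕ} {X : Type} [AddCommGroup X]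
    [Module R X] [Module.Finite R X] (h : DepthGE R n X) (h' : ¬ DepthGE R (n + 1) X)
    (hX : ∀ (Z : Type) [AddCommGroup Z] [Module R Z], ∀ i, e < i → ExtVanishes R i X Z) :
    ∃ (B : Type) (_ : AddCommGroup B) (_ : Module R B) (f : R ⧸ maximalIdeal R →ₗ[R] B),
      Module.Finite R B ∧ Function.Injective f ∧
      ∀ (Z : Type) [AddCommGroup Z] [Module R Z], ∀ i, e + n < i → ExtVanishes R i B Z := by
  induction n generalizing X e with
  | zero =>
    have h0 : ¬ ExtVanishes R 0 (R ⧸ maximalIdeal R) X := fun hc =>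
      h' fun i hi => by
        obtain rfl : i = 0 := by lia
        exact hc
    rw [ExtVanishes.zero_iff, not_subsingleton_iff_nontrivial] at h0
    obtain ⟨f, hf⟩ := exists_ne (0 : R ⧸ maximalIdeal R →ₗ[R] X)
    have : IsSimpleModule R (R ⧸ maximalIdeal R) :=
      isSimpleModule_iff_isCoatom.2 (maximalIdeal.isMaximal R).out
    exact ⟨X, _, _, f, inferInstance, f.injective_of_ne_zero hf, hX⟩
  | succ n ih =>
    obtain ⟨x, hx, hreg⟩ := h.exists_isSMulRegular
    have h2 : ¬ DepthGE R (n + 1) (QuotSMulTop x X) := fun hc =>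
      h' (DepthGE.of_mul_injective hx hreg (LinearMap.exact_lsmul_mkQ_smul_top X x)
        (Submodule.mkQ_surjective _) hc)
    obtain ⟨B, _, _, f, hB, hf, hv⟩ := ih (X := QuotSMulTop x X) (e := e + 1)
      (h.quotSMulTop hreg) h2 fun Z _ _ i hi => by
        obtain ⟨i, rfl⟩ := Nat.exists_eq_succ_of_ne_zero (Nat.ne_zero_of_lt hi)
        exact ExtVanishes.quot_left (f := LinearMap.lsmul R X x) hreg
          (LinearMap.exact_lsmul_mkQ_smul_top X x)
          (Submodule.mkQ_surjective _) (hX Z i (by lia)) (hX Z (i + 1) (by lia))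
    exact ⟨B, _, _, f, hB, hf, fun Z _ _ i hi => hv Z i (by lia)⟩

theorem ExtVanishes.of_forall_succ {n : ℕ} {Y : Type} [AddCommGroup Y] [Module R Y]
    [Module.Finite R Y] (hk : ExtVanishes R n (R ⧸ maximalIdeal R) Y)
    (h : ∀ (X : Type) [AddCommGroup X] [Module R X] [Module.Finite R X], ExtVanishes R (n + 1) X Y)
    (X : Type) [AddCommGroup X] [Module R X] [hfin : Module.Finite R X] : ExtVanishes R n X Y := by
  induction hfin using IsNoetherianRing.induction_on_isQuotientEquivQuotientPrime R with
  | subsingleton N => exact of_subsingleton_left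
  | quotient N p e =>
    refine congr_left e.symm ?_
    rcases (IsLocalRing.le_maximalIdeal p.2.ne_top).eq_or_lt with hp | hp
    · rw [hp]
      exact hk
    · obtain ⟨x, hx, hxp⟩ := SetLike.exists_of_lt hp
      have hinj : Function.Injective (LinearMap.lsmul R (R ⧸ p.1) x) := by
        rw [injective_iff_map_eq_zero]
        intro a ha
        obtain ⟨a, rfl⟩ := Ideal.Quotient.mk_surjective a
        have ha' : Ideal.Quotient.mk p.1 (x * a) = 0 := ha
        rw [Ideal.Quotient.eq_zero_iff_mem] at ha' ⊢
        exact (p.2.mem_or_mem ha').resolve_left hxp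
      exact of_mul_injective hx hinj (LinearMap.exact_lsmul_mkQ_smul_top _ x)
        (Submodule.mkQ_surjective _) (h _)
  | exact N₁ N₂ N₃ f g hf hg hfg h₁ h₃ => exact middle_left hf hfg hg h₁ h₃

theorem hasInjDimLE.extVanishes_of_depth_lt {n d : ℕ} (hd : DepthGE R d R)
    (hd' : ¬ DepthGE R (d + 1) R) {Y : Type} [AddCommGroup Y] [Module R Y] [Module.Finite R Y]
    (hY : hasInjDimLE R n Y) (i : ℕ) (hi : d < i) (X : Type) [AddCommGroup X] [Module R X]
    [Module.Finite R X] : ExtVanishes R i X Y := by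
  obtain ⟨B, _, _, f, hB, hf, hv⟩ := exists_injective_residue_of_depthGE d (e := 0) hd hd'
    fun Z _ _ i hi => by
      obtain ⟨i, rfl⟩ := Nat.exists_eq_succ_of_ne_zero hi.ne'
      exact ExtVanishes.of_projective
  rcases le_or_gt i (n + 1) with hin | hin
  · induction hin using Nat.decreasingInduction generalizing X with
    | self => exact hY.extVanishes n.lt_succ_self
    | of_succ r hr ih =>
      refine ExtVanishes.of_forall_succ ?_ (fun X => ih (by lia) X) X
      exact ExtVanishes.sub_left hf (LinearMap.exact_map_mkQ_range f)
        (Submodule.mkQ_surjective _) (hv Y r (by lia)) (ih (by lia) _)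
  · exact hY.extVanishes (by lia)

theorem DepthGE.extVanishes_of_lt {j d : ℕ} {X Y : Type} [AddCommGroup X] [Module R X]
    [Module.Finite R X] [AddCommGroup Y] [Module R Y] [Module.Finite R Y]
    (hX : DepthGE R j X)
    (hY : ∀ i, d < i → ∀ (X : Type) [AddCommGroup X] [Module R X] [Module.Finite R X],
      ExtVanishes R i X Y) {i : ℕ} (hi : d < i + j) : ExtVanishes R i X Y := by
  induction j generalizing X i with
  | zero => exact hY i hi X
  | succ j ih =>
    obtain ⟨x, hx, hreg⟩ := hX.exists_isSMulRegular
    exact ExtVanishes.of_mul_injective hx hreg (LinearMap.exact_lsmul_mkQ_smul_top X x)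
      (Submodule.mkQ_surjective _) (ih (hX.quotSMulTop hreg) (by lia))

end InjectiveDimensionBound

section ExtLength

variable {R : Type} [CommRing R] {A B C X Y : Type} [AddCommGroup A] [Module R A]
  [AddCommGroup B] [Module R B] [AddCommGroup C] [Module R C] [AddCommGroup X] [Module R X]
  [AddCommGroup Y] [Module R Y] {n : ℕ}

theorem Abelian.Ext.length_eq_add {f : A →ₗ[R] B} {g : B →ₗ[R] C} (hf : Function.Injective f)
    (hfg : Function.Exact f g) (hg : Function.Surjective g)
    (hA : ∀ m, m + 1 = n → ExtVanishes R m A Y) (hC : ExtVanishes R (n + 1) C Y) :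
    Module.length R (Abelian.Ext (ModuleCat.of R B) (ModuleCat.of R Y) n) =
      Module.length R (Abelian.Ext (ModuleCat.of R C) (ModuleCat.of R Y) n) +
      Module.length R (Abelian.Ext (ModuleCat.of R A) (ModuleCat.of R Y) n) := by
  have hS := LinearMap.shortExact_of_exact hf hfg hg
  refine Module.length_eq_add_of_exact
    (Abelian.Ext.precompOfLinear (Abelian.Ext.mk₀ (ModuleCat.ofHom g)) R _ (zero_add n))
    (Abelian.Ext.precompOfLinear (Abelian.Ext.mk₀ (ModuleCat.ofHom f)) R _ (zero_add n))
    ?_ ?_ ?_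
  · rw [injective_iff_map_eq_zero]
    intro x hx
    cases n with
    | zero =>
      obtain ⟨a, rfl⟩ := (Abelian.Ext.mk₀_bijective _ _).2 x
      have hx' : (Abelian.Ext.mk₀ (ModuleCat.ofHom g)).comp (Abelian.Ext.mk₀ a) (zero_add 0) = 0 :=
        hx
      rw [Abelian.Ext.mk₀_comp_mk₀, Abelian.Ext.mk₀_eq_zero_iff] at hx'
      have := hS.epi_g
      have ha : a = 0 := (cancel_epi (ModuleCat.ofHom g)).1 (hx'.trans Limits.comp_zero.symm)
      rw [ha, Abelian.Ext.mk₀_zero]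
    | succ m =>
      obtain ⟨y, rfl⟩ := Abelian.Ext.contravariant_sequence_exact₃ hS _ x hx (add_comm 1 m)
      rw [ExtVanishes.iff_forall.1 (hA m rfl) y, Abelian.Ext.comp_zero]
  · intro x
    obtain ⟨y, hy⟩ := Abelian.Ext.contravariant_sequence_exact₁ hS _ x (add_comm 1 n)
      (ExtVanishes.iff_forall.1 hC _)
    exact ⟨y, hy⟩
  · intro x
    constructor
    · intro hx
      exact Abelian.Ext.contravariant_sequence_exact₂ hS _ x hx
    · rintro ⟨y, rfl⟩
      change (Abelian.Ext.mk₀ (ModuleCat.ofHom f)).comp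
        ((Abelian.Ext.mk₀ (ModuleCat.ofHom g)).comp y (zero_add n)) (zero_add n) = 0
      rw [Abelian.Ext.mk₀_comp_mk₀_assoc, ← ModuleCat.ofHom_comp, hfg.linearMap_comp_eq_zero,
        ModuleCat.ofHom_zero, Abelian.Ext.mk₀_zero, Abelian.Ext.zero_comp]

/-- If `x` kills `X` and is regular on `Y`, then `Extⁿ(X, Y/xY) ≃ Extⁿ⁺¹(X, Y)` as soon as
`Extⁿ(X, Y)` vanishes. -/
theorem Abelian.Ext.nonempty_equiv_succ_of_mul_injective {x : R} (hx : x ∈ Module.annihilator R X)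
    {g : Y →ₗ[R] C} (hf : Function.Injective (LinearMap.lsmul R Y x))
    (hfg : Function.Exact (LinearMap.lsmul R Y x) g) (hg : Function.Surjective g)
    (h : ExtVanishes R n X Y) :
    Nonempty (Abelian.Ext (ModuleCat.of R X) (ModuleCat.of R C) n ≃ₗ[R]
      Abelian.Ext (ModuleCat.of R X) (ModuleCat.of R Y) (n + 1)) := by
  have hS := LinearMap.shortExact_of_exact hf hfg hg
  refine ⟨LinearEquiv.ofBijective (Abelian.Ext.postcompOfLinear hS.extClass R _ rfl) ⟨?_, ?_⟩⟩
  · rw [injective_iff_map_eq_zero]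
    intro y hy
    obtain ⟨z, rfl⟩ := Abelian.Ext.covariant_sequence_exact₃ _ hS y rfl hy
    rw [ExtVanishes.iff_forall.1 h z, Abelian.Ext.zero_comp]
  · intro y
    have hz := DFunLike.congr_fun (congrArg AddCommGrpCat.Hom.hom
      (Abelian.Ext.postcomp_smul_id_eq_zero_of_mem_annihilator (M := ModuleCat.of R Y)
      (N := ModuleCat.of R X) hx (n + 1))) y
    obtain ⟨z, hz⟩ := Abelian.Ext.covariant_sequence_exact₁ _ hS y hz rfl
    exact ⟨z, hz⟩

end ExtLength

section Canonical

variable {R : Type} [CommRing R] [IsLocalRing R] {W : Type} [AddCommGroup W] [Module R W]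

theorem IsSimpleModule.nonempty_equiv_residue {N : Type} [AddCommGroup N] [Module R N]
    [h : IsSimpleModule R N] : Nonempty (N ≃ₗ[R] R ⧸ maximalIdeal R) := by
  obtain ⟨I, hI, ⟨e⟩⟩ := isSimpleModule_iff_quot_maximal.1 h
  obtain rfl := IsLocalRing.eq_maximalIdeal hI
  exact ⟨e⟩

theorem IsFiniteLength.extVanishes_of_depthGE {d : ℕ} (hW : DepthGE R d W) {N : Type}
    [AddCommGroup N] [Module R N] (hN : IsFiniteLength R N) :
    ∀ i < d, ExtVanishes R i N W := by
  intro i hi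
  induction hN with
  | of_subsingleton => exact ExtVanishes.of_subsingleton_left
  | @of_simple_quotient M _ _ N _ _ ih =>
    obtain ⟨e⟩ := IsSimpleModule.nonempty_equiv_residue (R := R) (N := M ⧸ N)
    exact ExtVanishes.middle_left N.injective_subtype (LinearMap.exact_subtype_mkQ N)
      N.mkQ_surjective ih ((hW i hi).congr_left e.symm)

theorem IsFiniteLength.length_ext {d : ℕ} (hW : DepthGE R d W)
    (hd : ∀ (X : Type) [AddCommGroup X] [Module R X] [Module.Finite R X], ExtVanishes R (d + 1) X W)
    (hk : Nonempty (Abelian.Ext (ModuleCat.of R (R ⧸ maximalIdeal R)) (ModuleCat.of R W) d ≃ₗ[R]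
      (R ⧸ maximalIdeal R))) {N : Type}
    [AddCommGroup N] [Module R N] (hN : IsFiniteLength R N) :
    Module.length R (Abelian.Ext (ModuleCat.of R N) (ModuleCat.of R W) d) = Module.length R N := by
  have hzero : ∀ (Z : Type) [AddCommGroup Z] [Module R Z] [Subsingleton Z],
      Module.length R (Abelian.Ext (ModuleCat.of R Z) (ModuleCat.of R W) d) = 0 := fun Z _ _ _ => by
    have : Subsingleton (Abelian.Ext (ModuleCat.of R Z) (ModuleCat.of R W) d) :=
      ExtVanishes.of_subsingleton_left (R := R) (X := Z) (Y := W)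
    exact Module.length_eq_zero
  induction hN with
  | @of_subsingleton N => rw [hzero N, Module.length_eq_zero]
  | @of_simple_quotient M _ _ N _ hN ih =>
    obtain ⟨e⟩ := IsSimpleModule.nonempty_equiv_residue (R := R) (N := M ⧸ N)
    obtain ⟨ek⟩ := hk
    have h1 := Abelian.Ext.length_eq_add (n := d) (Y := W) N.injective_subtype
      (LinearMap.exact_subtype_mkQ N) N.mkQ_surjective
      (fun m hm => hN.extVanishes_of_depthGE hW m (by lia)) ((hd _).congr_left e.symm)
    have h2 := Abelian.Ext.length_eq_add (n := d) (Y := W) (f := (0 : PUnit →ₗ[R] M ⧸ N))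
      (g := e.toLinearMap) (Function.injective_of_subsingleton _)
      ((LinearMap.exact_zero_iff_injective _ _).2 e.injective) e.surjective
      (fun m _ => ExtVanishes.of_subsingleton_left) (hd _)
    rw [hzero PUnit, add_zero, ek.length_eq] at h2
    rw [h1, h2, ih, Module.length_eq_add_of_exact N.subtype N.mkQ N.injective_subtype
      N.mkQ_surjective (LinearMap.exact_subtype_mkQ N), e.length_eq, add_comm]

end Canonical

section ExtRegularSequence

open RingTheory.Sequence

variable {R : Type} [CommRing R]

theorem IsWeaklyRegular.nonempty_hom_equiv_ext {N Y : Type} [AddCommGroup N] [Module R N]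
    [AddCommGroup Y] [Module R Y] (rs : List R) (hrs : IsWeaklyRegular Y rs)
    (hN : ∀ r ∈ rs, r ∈ Module.annihilator R N)
    (h : ∀ i < rs.length, ExtVanishes R i N Y) :
    Nonempty ((N →ₗ[R] Y ⧸ (Ideal.ofList rs • ⊤ : Submodule R Y)) ≃ₗ[R]
      Abelian.Ext (ModuleCat.of R N) (ModuleCat.of R Y) rs.length) := by
  induction rs generalizing Y with
  | nil =>
    have e₁ : (Y ⧸ (Ideal.ofList ([] : List R) • ⊤ : Submodule R Y)) ≃ₗ[R] Y :=
      Submodule.quotEquivOfEqBot _ (by rw [Ideal.ofList_nil, Submodule.bot_smul])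
    have e₂ : (N →ₗ[R] Y) ≃ₗ[R] (ModuleCat.of R N ⟶ ModuleCat.of R Y) :=
      (ModuleCat.homLinearEquiv (S := R) (M := ModuleCat.of R N) (N := ModuleCat.of R Y)).symm
    exact ⟨(e₁.congrRight ≪≫ₗ e₂) ≪≫ₗ (Abelian.Ext.linearEquiv₀ (R := R)).symm⟩
  | cons r rs ih =>
    rw [isWeaklyRegular_cons_iff] at hrs
    obtain ⟨e₁⟩ := ih hrs.2 (fun s hs => hN s (List.mem_cons_of_mem _ hs)) fun i hi =>
      ExtVanishes.quot_right (f := LinearMap.lsmul R Y r) hrs.1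
        (LinearMap.exact_lsmul_mkQ_smul_top Y r) (Submodule.mkQ_surjective _)
        (h i (by simpa using hi.trans (Nat.lt_succ_self _))) (h (i + 1) (by simpa using hi))
    obtain ⟨e₂⟩ := Abelian.Ext.nonempty_equiv_succ_of_mul_injective (n := rs.length)
      (hN r List.mem_cons_self) hrs.1
      (LinearMap.exact_lsmul_mkQ_smul_top Y r) (Submodule.mkQ_surjective _)
      (h _ (by simp))
    exact ⟨((Submodule.quotOfListConsSMulTopEquivQuotSMulTopInner Y r rs).congrRight ≪≫ₗ e₁) ≪≫ₗ
      e₂⟩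

variable [IsLocalRing R] [IsNoetherianRing R]

theorem DepthGE.exists_isWeaklyRegular_pair {X Y : Type} [AddCommGroup X] [Module R X]
    [Module.Finite R X] [AddCommGroup Y] [Module R Y] [Module.Finite R Y] {n : ℕ}
    (hX : DepthGE R n X) (hY : DepthGE R n Y) :
    ∃ rs : List R, rs.length = n ∧ (∀ r ∈ rs, r ∈ maximalIdeal R) ∧
      IsWeaklyRegular X rs ∧ IsWeaklyRegular Y rs := by
  induction n generalizing X Y with
  | zero => exact ⟨[], rfl, by simp, .nil R X, .nil R Y⟩
  | succ n ih =>
    obtain ⟨x, hx, hreg⟩ := (hX.prod hY).exists_isSMulRegular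
    have hxX : IsSMulRegular X x := fun a b hab => by
      have := @hreg (a, 0) (b, 0) (Prod.ext hab rfl)
      exact congrArg Prod.fst this
    have hxY : IsSMulRegular Y x := fun a b hab => by
      have := @hreg (0, a) (0, b) (Prod.ext rfl hab)
      exact congrArg Prod.snd this
    obtain ⟨rs, hl, hm, h1, h2⟩ := ih (hX.quotSMulTop hxX) (hY.quotSMulTop hxY)
    exact ⟨x :: rs, by simp [hl], List.forall_mem_cons.2 ⟨hx, hm⟩,
      (isWeaklyRegular_cons_iff X x rs).2 ⟨hxX, h1⟩, (isWeaklyRegular_cons_iff Y x rs).2 ⟨hxY, h2⟩⟩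

end ExtRegularSequence

section Homothety

variable {R : Type} [CommRing R] [IsLocalRing R] [IsNoetherianRing R]
  {Y : Type} [AddCommGroup Y] [Module R Y] [Module.Finite R Y]

theorem homothety_mod_of_isSMulRegular {I : Ideal R} {x : R} (hx : x ∈ maximalIdeal R)
    (hreg : IsSMulRegular (Y ⧸ (I • ⊤ : Submodule R Y)) x) {J : Ideal R}
    (hJ : J = I ⊔ Ideal.span {x})
    (hs : Function.Surjective (LinearMap.toSpanSingleton R _ (J • ⊤ : Submodule R Y).mkQ))
    (hk : LinearMap.ker (LinearMap.toSpanSingleton R _ (J • ⊤ : Submodule R Y).mkQ) ≤ J) :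
    Function.Surjective (LinearMap.toSpanSingleton R _ (I • ⊤ : Submodule R Y).mkQ) ∧
    LinearMap.ker (LinearMap.toSpanSingleton R _ (I • ⊤ : Submodule R Y).mkQ) ≤ I := by
  have hxj : Ideal.span {x} ≤ Ideal.jacobson ⊥ := by
    rw [IsLocalRing.jacobson_eq_maximalIdeal ⊥ bot_ne_top, Ideal.span_singleton_le_iff_mem]
    exact hx
  have hIJ : (I • ⊤ : Submodule R Y) ≤ J • ⊤ := Submodule.smul_mono_left (hJ ▸ le_sup_left)
  have hJY : (J • ⊤ : Submodule R Y) = I • ⊤ ⊔ x • ⊤ := by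
    rw [hJ, Submodule.sup_smul, Submodule.ideal_span_singleton_smul]
  constructor
  · rw [← LinearMap.range_eq_top, ← top_le_iff]
    refine Submodule.le_of_le_smul_of_le_jacobson_bot Module.Finite.fg_top hxj fun g _ => ?_
    obtain ⟨r, hr⟩ := hs (Submodule.factor hIJ ∘ₗ g)
    have hval : ∀ y, ∃ w, x • w = g y - r • (I • ⊤ : Submodule R Y).mkQ y := fun y => by
      obtain ⟨z, hz⟩ := Submodule.mkQ_surjective _ (g y)
      have h1 := LinearMap.congr_fun hr y
      have h2 : z - r • y ∈ (J • ⊤ : Submodule R Y) := by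
        rw [← Submodule.ker_mkQ (J • ⊤ : Submodule R Y), LinearMap.mem_ker, map_sub, map_smul,
          sub_eq_zero]
        rw [LinearMap.comp_apply, ← hz] at h1
        exact h1.symm
      rw [hJY, Submodule.mem_sup] at h2
      obtain ⟨a, ha, b, hb, hab⟩ := h2
      obtain ⟨w, -, rfl⟩ := hb
      refine ⟨(I • ⊤ : Submodule R Y).mkQ w, ?_⟩
      rw [← hz, ← map_smul, ← map_smul, ← map_sub, ← hab, map_add,
        (Submodule.Quotient.mk_eq_zero _).2 ha |> fun h => (h : (I • ⊤ : Submodule R Y).mkQ a = 0),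
        zero_add]
      rfl
    choose w hw using hval
    let g' : Y →ₗ[R] Y ⧸ (I • ⊤ : Submodule R Y) :=
      { toFun := w
        map_add' := fun a b => hreg (by
          change x • w (a + b) = x • (w a + w b)
          rw [smul_add, hw, hw, hw, map_add, map_add, smul_add]; abel)
        map_smul' := fun c a => hreg (by
          change x • w (c • a) = x • (c • w a)
          rw [smul_comm, hw, hw, map_smul, map_smul, smul_sub, smul_comm c r]) }
    refine Submodule.mem_sup.2 ⟨r • (I • ⊤ : Submodule R Y).mkQ, ⟨r, rfl⟩, x • g',
      Submodule.smul_mem_smul (Ideal.mem_span_singleton_self x) trivial, ?_⟩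
    ext y
    change r • (I • ⊤ : Submodule R Y).mkQ y + x • w y = g y
    rw [hw, add_sub_cancel]
  · refine Submodule.le_of_le_smul_of_le_jacobson_bot (IsNoetherian.noetherian _) hxj
      fun a ha => ?_
    have ha' : ∀ y : Y, a • (I • ⊤ : Submodule R Y).mkQ y = 0 :=
      fun y => LinearMap.congr_fun (LinearMap.mem_ker.1 ha) y
    have haJ : a ∈ J := hk (by
      rw [LinearMap.mem_ker]
      ext y
      have := congrArg (Submodule.factor hIJ) (ha' y)
      rwa [map_smul, map_zero] at this)
    rw [hJ, Submodule.mem_sup] at haJ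
    obtain ⟨b, hb, c, hc, rfl⟩ := haJ
    obtain ⟨c, rfl⟩ := Ideal.mem_span_singleton'.1 hc
    refine Submodule.add_mem_sup hb ?_
    rw [mul_comm]
    refine Submodule.smul_mem_smul (Ideal.mem_span_singleton_self x) ?_
    rw [LinearMap.mem_ker]
    ext y
    apply hreg
    change x • c • (I • ⊤ : Submodule R Y).mkQ y = x • (0 : Y ⧸ (I • ⊤ : Submodule R Y))
    have hb' : b • (I • ⊤ : Submodule R Y).mkQ y = 0 := by
      rw [← map_smul]
      exact (Submodule.Quotient.mk_eq_zero _).2 (Submodule.smul_mem_smul hb trivial)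
    have := ha' y
    rw [add_smul, hb', zero_add, mul_comm, mul_smul] at this
    rw [this, smul_zero]

end Homothety

section LengthDuality

variable {R : Type} [CommRing R]

theorem Ideal.nonempty_quotient_hom_equiv {I : Ideal R} {W : Type} [AddCommGroup W] [Module R W]
    (h : I ≤ Module.annihilator R W) : Nonempty (((R ⧸ I) →ₗ[R] W) ≃ₗ[R] W) := by
  refine ⟨LinearEquiv.ofBijective (LinearMap.applyₗ (1 : R ⧸ I)) ⟨fun f g hfg => ?_, fun w => ?_⟩⟩
  · refine Submodule.linearMap_qext _ (LinearMap.ext_ring ?_)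
    exact hfg
  · exact ⟨Submodule.liftQ I (LinearMap.toSpanSingleton R W w) fun a ha => by
      simpa using Module.mem_annihilator.1 (h ha) w, one_smul R w⟩

theorem Module.surjective_of_injective_of_length_le {A B : Type*} [AddCommGroup A] [Module R A]
    [AddCommGroup B] [Module R B] {f : A →ₗ[R] B} (hf : Function.Injective f)
    (hA : Module.length R A ≠ ⊤) (h : Module.length R B ≤ Module.length R A) :
    Function.Surjective f := by
  have h1 := Module.length_eq_add_of_exact f (LinearMap.range f).mkQ hf
    (Submodule.mkQ_surjective _) (LinearMap.exact_map_mkQ_range f)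
  rw [h1] at h
  have h2 : Module.length R (B ⧸ LinearMap.range f) = 0 := by
    have := (ENat.add_le_add_iff_left (m := 0) hA).1 (h.trans_eq (add_zero _).symm)
    exact nonpos_iff_eq_zero.1 this
  rw [Module.length_eq_zero_iff, Submodule.Quotient.subsingleton_iff,
    LinearMap.range_eq_top] at h2
  exact h2

/-- If `N ↦ Hom(N, W)` preserves the length of modules killed by an ideal `I` of finite colength
which kills `W`, then `R ⧸ I` is the ring of endomorphisms of `W`. -/
theorem Ideal.homothety_of_length_hom {I : Ideal R} (hI : IsFiniteLength R (R ⧸ I)) {W : Type}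
    [AddCommGroup W] [Module R W] (hW : I ≤ Module.annihilator R W)
    (h : ∀ (N : Type) [AddCommGroup N] [Module R N], IsFiniteLength R N →
      I ≤ Module.annihilator R N → Module.length R (N →ₗ[R] W) = Module.length R N) :
    Module.annihilator R W = I ∧
    Function.Surjective (LinearMap.toSpanSingleton R _ (LinearMap.id : W →ₗ[R] W)) := by
  obtain ⟨e₁⟩ := Ideal.nonempty_quotient_hom_equiv hW
  obtain ⟨e₂⟩ := Ideal.nonempty_quotient_hom_equiv (le_refl (Module.annihilator R W))
  set K := Module.annihilator R W
  have hfI := Module.length_ne_top_iff.2 hI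
  have hle : Module.length R (R ⧸ K) ≤ Module.length R (R ⧸ I) :=
    Module.length_le_of_surjective (Submodule.factor hW) (Submodule.factor_surjective hW)
  have hfK : Module.length R (R ⧸ K) ≠ ⊤ := (hle.trans_lt hfI.lt_top).ne
  have h₁ : Module.length R W = Module.length R (R ⧸ I) := by
    rw [← h (R ⧸ I) hI (by rw [Ideal.annihilator_quotient]), e₁.length_eq]
  have h₂ : Module.length R W = Module.length R (R ⧸ K) := by
    rw [← h (R ⧸ K) (Module.length_ne_top_iff.1 hfK) (by rwa [Ideal.annihilator_quotient]),
      e₂.length_eq]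
  have h₃ : Module.length R (W →ₗ[R] W) = Module.length R W :=
    h W (Module.length_ne_top_iff.1 (h₁ ▸ hfI)) hW
  constructor
  · refine le_antisymm (fun a ha => ?_) hW
    have h4 := Module.length_eq_add_of_exact (LinearMap.ker (Submodule.factor hW)).subtype
      (Submodule.factor hW) (Submodule.injective_subtype _) (Submodule.factor_surjective hW)
      (LinearMap.exact_subtype_ker_map _)
    rw [← h₁, h₂] at h4
    have h5 : Module.length R (LinearMap.ker (Submodule.factor hW)) = 0 := by
      have := (ENat.add_le_add_iff_right (m := 0) hfK).1 (h4.ge.trans_eq (zero_add _).symm)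
      exact nonpos_iff_eq_zero.1 this
    rw [Module.length_eq_zero_iff, Submodule.subsingleton_iff_eq_bot] at h5
    have : (Submodule.mkQ I a) ∈ LinearMap.ker (Submodule.factor hW) := by
      rw [LinearMap.mem_ker]
      exact (Submodule.Quotient.mk_eq_zero _).2 ha
    rw [h5, Submodule.mem_bot] at this
    exact (Submodule.Quotient.mk_eq_zero _).1 this
  · have hker : LinearMap.ker (LinearMap.toSpanSingleton R _ (LinearMap.id : W →ₗ[R] W)) = K := by
      ext a
      rw [LinearMap.mem_ker, Module.mem_annihilator]
      exact ⟨fun h w => LinearMap.congr_fun h w, fun h => LinearMap.ext h⟩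
    have hs := Module.surjective_of_injective_of_length_le
      (f := K.liftQ (LinearMap.toSpanSingleton R _ (LinearMap.id : W →ₗ[R] W)) hker.ge)
      (LinearMap.ker_eq_bot.1 (Submodule.ker_liftQ_eq_bot _ _ _ hker.le)) hfK
      (by rw [h₃, h₂])
    rw [← LinearMap.range_eq_top, Submodule.range_liftQ, LinearMap.range_eq_top] at hs
    exact hs

end LengthDuality

section Homothety

open RingTheory.Sequence

variable {R : Type} [CommRing R] [IsLocalRing R] [IsNoetherianRing R]

theorem IsWeaklyRegular.isFiniteLength_quotient {rs : List R} (hm : ∀ r ∈ rs, r ∈ maximalIdeal R)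
    (h : IsWeaklyRegular R rs) (hd : ringKrullDim R = rs.length) :
    IsFiniteLength R (R ⧸ Ideal.ofList rs) := by
  have hle : Ideal.ofList rs ≤ maximalIdeal R := Ideal.span_le.2 hm
  have hne : Ideal.ofList rs ≠ ⊤ := fun hc => (maximalIdeal.isMaximal R).ne_top
    (top_le_iff.1 (hc ▸ hle))
  have hreg : IsRegular R rs := ⟨h, by simpa using hne.symm⟩
  have h1 := ringKrullDim_add_length_eq_ringKrullDim_of_isRegular rs hreg
  have : Nontrivial (R ⧸ Ideal.ofList rs) := Ideal.Quotient.nontrivial_iff.2 hne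
  have h2 : ringKrullDim (R ⧸ Ideal.ofList rs) = 0 := by
    rw [hd] at h1
    generalize ringKrullDim (R ⧸ Ideal.ofList rs) = t at h1
    induction t with
    | bot => simp at h1
    | coe a =>
      norm_cast at h1 ⊢
      exact (ENat.add_left_injective_of_ne_top (ENat.natCast_ne_top rs.length))
        (h1.trans (zero_add _).symm)
  have h3 : Ring.KrullDimLE 0 (R ⧸ Ideal.ofList rs) := by
    rw [Ring.krullDimLE_iff, h2]
    rfl
  have h4 : IsArtinianRing (R ⧸ Ideal.ofList rs) :=
    isArtinianRing_iff_krullDimLE_zero.2 h3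
  have h5 : IsArtinian R (R ⧸ Ideal.ofList rs) :=
    isArtinian_of_surjective_algebraMap (R := R ⧸ Ideal.ofList rs) Ideal.Quotient.mk_surjective
  exact isFiniteLength_iff_isNoetherian_isArtinian.2 ⟨inferInstance, h5⟩

theorem homothety_bijective {d : ℕ} (hd : ringKrullDim R = d) (hR : DepthGE R d R) {Y : Type}
    [AddCommGroup Y] [Module R Y] [Module.Finite R Y] (hY : DepthGE R d Y)
    (hv : ∀ (X : Type) [AddCommGroup X] [Module R X] [Module.Finite R X], ExtVanishes R (d + 1) X Y)
    (hk : Nonempty (Abelian.Ext (ModuleCat.of R (R ⧸ maximalIdeal R)) (ModuleCat.of R Y) d ≃ₗ[R]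
      (R ⧸ maximalIdeal R))) :
    Function.Bijective (LinearMap.toSpanSingleton R _ (LinearMap.id : Y →ₗ[R] Y)) := by
  obtain ⟨rs, rfl, hm, hrR, hrY⟩ := hR.exists_isWeaklyRegular_pair hY
  have key : ∀ i ≤ rs.length,
      Function.Surjective (LinearMap.toSpanSingleton R _
        (Ideal.ofList (rs.take i) • ⊤ : Submodule R Y).mkQ) ∧
      LinearMap.ker (LinearMap.toSpanSingleton R _
        (Ideal.ofList (rs.take i) • ⊤ : Submodule R Y).mkQ) ≤ Ideal.ofList (rs.take i) := by
    intro i hi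
    induction hi using Nat.decreasingInduction with
    | self =>
      rw [List.take_length]
      set I := Ideal.ofList rs
      have hIW : I ≤ Module.annihilator R (Y ⧸ (I • ⊤ : Submodule R Y)) := fun a ha => by
        rw [Module.mem_annihilator]
        intro w
        obtain ⟨y, rfl⟩ := Submodule.mkQ_surjective _ w
        rw [← map_smul]
        exact (Submodule.Quotient.mk_eq_zero _).2 (Submodule.smul_mem_smul ha trivial)
      obtain ⟨h1, h2⟩ := Ideal.homothety_of_length_hom
        (IsWeaklyRegular.isFiniteLength_quotient hm hrR hd) hIW fun N _ _ hN hI => by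
          obtain ⟨e⟩ := IsWeaklyRegular.nonempty_hom_equiv_ext (N := N) rs hrY
            (fun r hr => hI (Ideal.subset_span hr)) (hN.extVanishes_of_depthGE hY)
          rw [e.length_eq, hN.length_ext hY hv hk]
      constructor
      · intro g
        have hg : (I • ⊤ : Submodule R Y) ≤ LinearMap.ker g :=
          Submodule.smul_le.2 fun a ha y _ => by
            rw [LinearMap.mem_ker, map_smul]
            exact Module.mem_annihilator.1 (hIW ha) _
        obtain ⟨a, ha⟩ := h2 (Submodule.liftQ _ g hg)
        refine ⟨a, ?_⟩
        ext y
        exact LinearMap.congr_fun ha ((I • ⊤ : Submodule R Y).mkQ y)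
      · intro a ha
        refine h1.le ?_
        rw [Module.mem_annihilator]
        intro w
        obtain ⟨y, rfl⟩ := Submodule.mkQ_surjective _ w
        exact LinearMap.congr_fun (LinearMap.mem_ker.1 ha) y
    | of_succ i hi ih =>
      refine homothety_mod_of_isSMulRegular (hm rs[i] (List.getElem_mem _))
        (hrY.regular_mod_prev i hi) ?_ ih.1 ih.2
      rw [List.take_succ_eq_append_getElem hi, Ideal.ofList_append, Ideal.ofList_singleton]
  obtain ⟨h1, h2⟩ := key 0 (Nat.zero_le _)
  rw [List.take_zero, Ideal.ofList_nil] at h2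
  constructor
  · rw [← LinearMap.ker_eq_bot, ← le_bot_iff]
    refine le_trans (fun a ha => ?_) h2
    rw [LinearMap.mem_ker] at ha ⊢
    ext y
    exact congrArg _ (LinearMap.congr_fun ha y)
  · intro g
    obtain ⟨a, ha⟩ := h1 ((Ideal.ofList (rs.take 0) • ⊤ : Submodule R Y).mkQ ∘ₗ g)
    refine ⟨a, ?_⟩
    ext y
    have := LinearMap.congr_fun ha y
    have h3 : a • y - g y ∈ (Ideal.ofList (rs.take 0) • ⊤ : Submodule R Y) := by
      rw [← Submodule.ker_mkQ (Ideal.ofList (rs.take 0) • ⊤ : Submodule R Y), LinearMap.mem_ker,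
        map_sub, map_smul, sub_eq_zero]
      exact this
    rw [List.take_zero, Ideal.ofList_nil, Submodule.bot_smul, Submodule.mem_bot, sub_eq_zero] at h3
    exact h3

end Homothety

section HomExtension

variable {R : Type} [CommRing R] {A B C X Y : Type} [AddCommGroup A] [Module R A]
  [AddCommGroup B] [Module R B] [AddCommGroup C] [Module R C] [AddCommGroup X] [Module R X]
  [AddCommGroup Y] [Module R Y]

theorem ExtVanishes.lcomp_surjective {f : A →ₗ[R] B} {g : B →ₗ[R] C} (hf : Function.Injective f)
    (hfg : Function.Exact f g) (hg : Function.Surjective g) (hC : ExtVanishes R 1 C Y) :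
    Function.Surjective (LinearMap.lcomp R Y f) := fun u => by
  obtain ⟨x, hx⟩ := Abelian.Ext.contravariant_sequence_exact₁
    (LinearMap.shortExact_of_exact hf hfg hg) _ (Abelian.Ext.mk₀ (ModuleCat.ofHom u))
    (add_comm 1 0) (ExtVanishes.iff_forall.1 hC _)
  obtain ⟨v, rfl⟩ := (Abelian.Ext.mk₀_bijective _ _).2 x
  rw [Abelian.Ext.mk₀_comp_mk₀] at hx
  have h := (Abelian.Ext.mk₀_bijective _ _).1 hx
  exact ⟨v.hom, congrArg ModuleCat.Hom.hom h⟩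

theorem Module.Finite.linearMap_of_isNoetherianRing [IsNoetherianRing R] [Module.Finite R X]
    [Module.Finite R Y] : Module.Finite R (X →ₗ[R] Y) := by
  obtain ⟨n, p, hp⟩ := Module.Finite.exists_fin' R X
  exact Module.Finite.of_injective (LinearMap.lcomp R Y p)
    (LinearMap.lcomp_injective_of_surjective p hp)

variable (R) in
/-- The evaluation map from `X` to its double dual with respect to `Y`. -/
abbrev bidualMap (X Y : Type) [AddCommGroup X] [Module R X] [AddCommGroup Y] [Module R Y] :
    X →ₗ[R] (X →ₗ[R] Y) →ₗ[R] Y :=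
  (LinearMap.id : (X →ₗ[R] Y) →ₗ[R] (X →ₗ[R] Y)).flip

theorem bidualMap_pi_bijective
    (h : Function.Bijective (LinearMap.toSpanSingleton R _ (LinearMap.id : Y →ₗ[R] Y))) (n : ℕ) :
    Function.Bijective (bidualMap R (Fin n → R) Y) := by
  constructor
  · rw [injective_iff_map_eq_zero]
    intro x hx
    ext i
    apply h.1
    ext y
    have := LinearMap.congr_fun hx ((LinearMap.proj i).smulRight y)
    simpa using this
  · intro Φ
    choose a ha using fun i : Fin n =>
      h.2 (Φ ∘ₗ (LinearEquiv.piRing R Y (Fin n) R).symm.toLinearMap ∘ₗ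
        LinearMap.single R (fun _ => Y) i)
    refine ⟨a, ?_⟩
    ext f
    obtain ⟨y, rfl⟩ := (LinearEquiv.piRing R Y (Fin n) R).symm.surjective f
    have hy : y = ∑ i, Pi.single i (y i) := (Finset.univ_sum_single y).symm
    have h1 : Φ ((LinearEquiv.piRing R Y (Fin n) R).symm y) = ∑ i, a i • y i := by
      conv_lhs => rw [hy]
      rw [map_sum, map_sum]
      exact Finset.sum_congr rfl fun i _ => (LinearMap.congr_fun (ha i) (y i)).symm
    rw [h1]
    exact LinearEquiv.piRing_symm_apply (R := R) (M := Y) (S := R) y a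

end HomExtension

section Dualizing

/-- The homological properties of a canonical module which provide a duality on maximal
Cohen–Macaulay modules. -/
structure IsDualizing (R : Type) [CommRing R] [IsLocalRing R] (d : ℕ) (Y : Type) [AddCommGroup Y]
    [Module R Y] : Prop where
  finite : Module.Finite R Y
  depth_self : DepthGE R d R
  depth : DepthGE R d Y
  ext : ∀ (X : Type) [AddCommGroup X] [Module R X] [Module.Finite R X], DepthGE R d X →
    ExtVanishes R 1 X Y
  homothety : Function.Bijective (LinearMap.toSpanSingleton R _ (LinearMap.id : Y →ₗ[R] Y))

namespace IsDualizing

variable {R : Type} [CommRing R] [IsLocalRing R] {d : ℕ} {Y : Type} [AddCommGroup Y] [Module R Y]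
  (hY : IsDualizing R d Y) {X : Type} [AddCommGroup X] [Module R X]

include hY

theorem depthGE_ker {n : ℕ} {p : (Fin n → R) →ₗ[R] X} (hp : Function.Surjective p)
    (hX : DepthGE R d X) : DepthGE R d (LinearMap.ker p) :=
  DepthGE.sub (Submodule.injective_subtype _) (LinearMap.exact_subtype_ker_map p) hp
    (hY.depth_self.pi n) hX

variable [IsNoetherianRing R] [Module.Finite R X]

theorem depthGE_hom (hX : DepthGE R d X) : DepthGE R d (X →ₗ[R] Y) := by
  have := hY.finite
  suffices h : ∀ j ≤ d, ∀ (X : Type) [AddCommGroup X] [Module R X] [Module.Finite R X],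
      DepthGE R d X → DepthGE R j (X →ₗ[R] Y) from h d le_rfl X hX
  intro j hj
  induction j with
  | zero => exact @fun _ _ _ _ _ => DepthGE.zero
  | succ j ih =>
    intro X _ _ _ hX
    obtain ⟨n, p, hp⟩ := Module.Finite.exists_fin' R X
    have hK := hY.depthGE_ker hp hX
    exact DepthGE.sub_succ (LinearMap.lcomp_injective_of_surjective p hp)
      (LinearMap.exact_lcomp_of_exact_of_surjective Y (LinearMap.exact_subtype_ker_map p) hp)
      ((hY.ext X hX).lcomp_surjective (Submodule.injective_subtype _)
        (LinearMap.exact_subtype_ker_map p) hp)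
      (((hY.depth.pi n).congr (LinearEquiv.piRing R Y (Fin n) R).symm).mono hj)
      (ih (by lia) _ hK)

theorem bidualMap_surjective (hX : DepthGE R d X) : Function.Surjective (bidualMap R X Y) := by
  have := hY.finite
  obtain ⟨n, p, hp⟩ := Module.Finite.exists_fin' R X
  have hK := hY.depthGE_ker hp hX
  have := Module.Finite.linearMap_of_isNoetherianRing (R := R) (X := LinearMap.ker p) (Y := Y)
  intro Φ
  obtain ⟨Ψ, rfl⟩ := (hY.ext _ (hY.depthGE_hom hK)).lcomp_surjective (Y := Y)
    (LinearMap.lcomp_injective_of_surjective p hp)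
    (LinearMap.exact_lcomp_of_exact_of_surjective Y (LinearMap.exact_subtype_ker_map p) hp)
    ((hY.ext X hX).lcomp_surjective (Submodule.injective_subtype _)
      (LinearMap.exact_subtype_ker_map p) hp) Φ
  obtain ⟨a, rfl⟩ := (bidualMap_pi_bijective hY.homothety n).2 Ψ
  exact ⟨p a, rfl⟩

theorem bidualMap_bijective (hX : DepthGE R d X) : Function.Bijective (bidualMap R X Y) := by
  refine ⟨?_, hY.bidualMap_surjective hX⟩
  obtain ⟨n, p, hp⟩ := Module.Finite.exists_fin' R X
  have hK := hY.depthGE_ker hp hX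
  have hex := LinearMap.exact_lcomp_of_exact_of_surjective Y (LinearMap.exact_subtype_ker_map p) hp
  have hsurj := (hY.ext X hX).lcomp_surjective (Submodule.injective_subtype _)
    (LinearMap.exact_subtype_ker_map p) hp
  rw [injective_iff_map_eq_zero]
  intro x hx
  obtain ⟨a, rfl⟩ := hp x
  obtain ⟨Ψ, hΨ⟩ := (LinearMap.exact_lcomp_of_exact_of_surjective Y hex hsurj
    (bidualMap R (Fin n → R) Y a)).1 hx
  obtain ⟨k, rfl⟩ := hY.bidualMap_surjective hK Ψ
  have hk : (k : Fin n → R) = a := (bidualMap_pi_bijective hY.homothety n).1 hΨ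
  rw [← hk]
  exact k.2

theorem exists_coresolution (hX : DepthGE R d X) :
    ∃ (n : ℕ) (C : Type) (_ : AddCommGroup C) (_ : Module R C) (f : X →ₗ[R] (Fin n → Y))
      (g : (Fin n → Y) →ₗ[R] C), Module.Finite R C ∧ DepthGE R d C ∧ Function.Injective f ∧
      Function.Exact f g ∧ Function.Surjective g := by
  have := hY.finite
  have := Module.Finite.linearMap_of_isNoetherianRing (R := R) (X := X) (Y := Y)
  have hX' := hY.depthGE_hom hX
  obtain ⟨n, q, hq⟩ := Module.Finite.exists_fin' R (X →ₗ[R] Y)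
  let e := LinearEquiv.piRing R Y (Fin n) R
  let b := LinearEquiv.ofBijective _ (hY.bidualMap_bijective hX)
  have hex := LinearMap.exact_lcomp_of_exact_of_surjective Y (LinearMap.exact_subtype_ker_map q) hq
  refine ⟨n, LinearMap.ker q →ₗ[R] Y, inferInstance, inferInstance,
    e.toLinearMap.comp ((LinearMap.lcomp R Y q).comp b.toLinearMap),
    (LinearMap.lcomp R Y (LinearMap.ker q).subtype).comp e.symm.toLinearMap,
    Module.Finite.linearMap_of_isNoetherianRing, hY.depthGE_hom (hY.depthGE_ker hq hX'), ?_, ?_, ?_⟩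
  · have hqY : Function.Injective (LinearMap.lcomp R Y q) :=
      LinearMap.lcomp_injective_of_surjective q hq
    exact e.injective.comp (hqY.comp b.injective)
  · intro y
    refine (hex (e.symm y)).trans ⟨?_, ?_⟩
    · rintro ⟨Φ, hΦ⟩
      obtain ⟨x, rfl⟩ := b.surjective Φ
      exact ⟨x, (e.eq_symm_apply).1 hΦ⟩
    · rintro ⟨x, hx⟩
      exact ⟨b x, (e.eq_symm_apply).2 hx⟩
  · exact ((hY.ext _ hX').lcomp_surjective (Submodule.injective_subtype _)
      (LinearMap.exact_subtype_ker_map q) hq).comp e.symm.surjective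

theorem depthGE_coker_lcomp {A B : Type} [AddCommGroup A] [Module R A] [Module.Finite R A]
    [AddCommGroup B] [Module R B] [Module.Finite R B] (g : A →ₗ[R] B) (hA : DepthGE R d A)
    (hB : DepthGE R d B) (hC : DepthGE R d (B ⧸ LinearMap.range g)) :
    DepthGE R d ((A →ₗ[R] Y) ⧸ LinearMap.range (LinearMap.lcomp R Y g)) := by
  have hI : DepthGE R d (LinearMap.range g) :=
    DepthGE.sub (Submodule.injective_subtype _) (LinearMap.exact_subtype_mkQ _)
      (Submodule.mkQ_surjective _) hB hC
  have hex : Function.Exact (LinearMap.ker g).subtype g.rangeRestrict :=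
    (LinearMap.ker_rangeRestrict g) ▸ LinearMap.exact_subtype_ker_map g.rangeRestrict
  have hK : DepthGE R d (LinearMap.ker g) :=
    DepthGE.sub (Submodule.injective_subtype _) hex g.surjective_rangeRestrict hA hI
  have hsurj := (hY.ext _ hI).lcomp_surjective (Submodule.injective_subtype _) hex
    g.surjective_rangeRestrict
  have hext := (hY.ext _ hC).lcomp_surjective (Submodule.injective_subtype _)
    (LinearMap.exact_subtype_mkQ _) (Submodule.mkQ_surjective _)
  have hker : LinearMap.ker (LinearMap.lcomp R Y (LinearMap.ker g).subtype) =
      LinearMap.range (LinearMap.lcomp R Y g) := by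
    ext u
    refine (LinearMap.exact_lcomp_of_exact_of_surjective Y hex
      g.surjective_rangeRestrict u).trans ⟨?_, ?_⟩
    · rintro ⟨v, rfl⟩
      obtain ⟨w, rfl⟩ := hext v
      exact ⟨w, rfl⟩
    · rintro ⟨w, rfl⟩
      exact ⟨w ∘ₗ (LinearMap.range g).subtype, rfl⟩
  exact (hY.depthGE_hom hK).congr
    ((Submodule.quotEquivOfEq _ _ hker.symm).trans
      (LinearMap.quotKerEquivOfSurjective _ hsurj)).symm

theorem depthGE_coker_iff {m n : ℕ} (f : (Fin n → R) →ₗ[R] (Fin m → R)) :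
    DepthGE R d ((Fin m → R) ⧸ LinearMap.range f) ↔
      DepthGE R d (((Fin n → R) →ₗ[R] Y) ⧸ LinearMap.range (LinearMap.lcomp R Y f)) := by
  have := hY.finite
  refine ⟨hY.depthGE_coker_lcomp f (hY.depth_self.pi n) (hY.depth_self.pi m), fun h => ?_⟩
  have hfree : ∀ k, DepthGE R d ((Fin k → R) →ₗ[R] Y) :=
    fun k => hY.depthGE_hom (hY.depth_self.pi k)
  have := hY.depthGE_coker_lcomp _ (hfree m) (hfree n) h
  refine this.congr (Submodule.Quotient.equiv _ _
    (LinearEquiv.ofBijective _ (bidualMap_pi_bijective hY.homothety m)) ?_).symm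
  ext Φ
  constructor
  · rintro ⟨_, ⟨a, rfl⟩, rfl⟩
    exact ⟨bidualMap R _ Y a, rfl⟩
  · rintro ⟨Ψ, rfl⟩
    obtain ⟨a, rfl⟩ := (bidualMap_pi_bijective hY.homothety n).2 Ψ
    exact ⟨f a, ⟨a, rfl⟩, rfl⟩

end IsDualizing

end Dualizing

section Main

variable {R : Type} [CommRing R] [IsNoetherianRing R] [IsLocalRing R] {d : ℕ} {Y : Type}
  [AddCommGroup Y] [Module R Y]

omit [IsLocalRing R] in
theorem exists_ringKrullDim_localization_eq (p : Ideal R) [p.IsPrime] :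
    ∃ j : ℕ, ringKrullDim (Localization.AtPrime p) = j := by
  rw [IsLocalization.AtPrime.ringKrullDim_eq_height p]
  obtain ⟨j, hj⟩ := ENat.ne_top_iff_exists.1 (Ideal.height_ne_top (I := p) Ideal.IsPrime.ne_top')
  exact ⟨j, by rw [← hj]; rfl⟩

theorem IsDualizing.isMCM (hY : IsDualizing R d Y) (h : IsMCM R Y) {X : Type} [AddCommGroup X]
    [Module R X] [Module.Finite R X] (hX : DepthGE R d X) : IsMCM R X := by
  intro p hp
  have := hY.finite
  obtain ⟨e, he⟩ := exists_ringKrullDim_localization_eq p.asIdeal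
  have : IsNoetherianRing (Localization.AtPrime p.asIdeal) :=
    IsLocalization.isNoetherianRing p.asIdeal.primeCompl _ inferInstance
  rw [DepthGE.moduleDepth_eq_iff he]
  have hYp : DepthGE (Localization.AtPrime p.asIdeal) e
      (LocalizedModule p.asIdeal.primeCompl Y) := by
    rcases subsingleton_or_nontrivial (LocalizedModule p.asIdeal.primeCompl Y) with hs | hn
    · exact DepthGE.of_subsingleton
    · exact (DepthGE.moduleDepth_eq_iff he).1 (h p hn)
  clear hp
  suffices H : ∀ j ≤ e, ∀ (X : Type) [AddCommGroup X] [Module R X] [Module.Finite R X],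
      DepthGE R d X → DepthGE (Localization.AtPrime p.asIdeal) j
        (LocalizedModule p.asIdeal.primeCompl X) from H e le_rfl X hX
  intro j hj
  induction j with
  | zero => exact @fun _ _ _ _ _ => DepthGE.zero
  | succ j ih =>
    intro X _ _ _ hX
    obtain ⟨n, C, _, _, f, g, _, hC, hf, hfg, hg⟩ := hY.exists_coresolution hX
    let S := p.asIdeal.primeCompl
    let l : (Fin n → Y) →ₗ[R] (Fin n → LocalizedModule S Y) :=
      LinearMap.pi fun i => LocalizedModule.mkLinearMap S Y ∘ₗ LinearMap.proj i
    have : IsLocalizedModule S l := inferInstance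
    let u : LocalizedModule S (Fin n → Y) ≃ₗ[R] (Fin n → LocalizedModule S Y) :=
      IsLocalizedModule.iso S l
    let u' : LocalizedModule S (Fin n → Y) ≃ₗ[Localization S] (Fin n → LocalizedModule S Y) :=
      u.extendScalarsOfIsLocalization S (Localization S)
    have hex : Function.Exact (LocalizedModule.map S f) (LocalizedModule.map S g) :=
      LocalizedModule.map_exact S f g hfg
    exact DepthGE.sub_succ (LocalizedModule.map_injective S f hf) hex
      (LocalizedModule.map_surjective S g hg) (((hYp.pi n).congr u'.symm).mono hj) (ih (by lia) C hC)

theorem IsCanonicalModule.isDualizing (hCM : IsCMLocal R) (hY : IsCanonicalModule R Y) :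
    ∃ d : ℕ, ringKrullDim R = d ∧ IsDualizing R d Y := by
  obtain ⟨hfin, hm, ⟨n, hn⟩, d, hd, ⟨e⟩⟩ := hY
  have hR : DepthGE R d R := (DepthGE.moduleDepth_eq_iff hd).1 hCM
  have hR' : ¬ DepthGE R (d + 1) R := by
    intro h
    have h1 := le_moduleDepth_iff.2 h
    have h2 : (moduleDepth R R : WithBot ℕ∞) = (d : ℕ∞) := hCM.trans hd
    rw [WithBot.coe_inj.1 h2] at h1
    norm_cast at h1
    lia
  have hv : ∀ i, d < i → ∀ (X : Type) [AddCommGroup X] [Module R X] [Module.Finite R X],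
      ExtVanishes R i X Y := fun i hi X _ _ _ => hn.extVanishes_of_depth_lt hR hR' i hi X
  obtain ⟨e'⟩ := nonempty_extGroup_equiv (R := R) d (R ⧸ maximalIdeal R) Y
  exact ⟨d, hd, hfin, hR, hm.depthGE hd, fun X _ _ _ hX => hX.extVanishes_of_lt hv (by lia),
    homothety_bijective hd hR (hm.depthGE hd) (hv (d + 1) (by lia)) ⟨e'.symm.trans e⟩⟩

/-- The tensor product of the cokernel of `f.dualMap` with `Y` is the cokernel of
precomposition with `f` on maps into `Y`. -/
theorem nonempty_coker_dualMap_tensor_equiv {R Y : Type} [CommRing R] [AddCommGroup Y] [Module R Y]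
    {m n : ℕ} (f : (Fin n → R) →ₗ[R] (Fin m → R)) :
    Nonempty (((Module.Dual R (Fin n → R) ⧸ LinearMap.range f.dualMap) ⊗[R] Y) ≃ₗ[R]
      (((Fin n → R) →ₗ[R] Y) ⧸ LinearMap.range (LinearMap.lcomp R Y f))) := by
  have hex : Function.Exact f.dualMap (LinearMap.range f.dualMap).mkQ :=
    LinearMap.exact_map_mkQ_range _
  let E := rTensor.equiv Y hex (Submodule.mkQ_surjective _)
  have hcomm : ∀ z : Module.Dual R (Fin m → R) ⊗[R] Y,
      dualTensorHomEquiv R (Fin n → R) Y (f.dualMap.rTensor Y z) =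
        LinearMap.lcomp R Y f (dualTensorHomEquiv R (Fin m → R) Y z) := by
    intro z
    induction z with
    | zero => simp
    | add x y hx hy => simp only [map_add, hx, hy]
    | tmul φ y =>
      ext
      simp
  refine ⟨E.symm.trans (Submodule.Quotient.equiv _ _ (dualTensorHomEquiv R (Fin n → R) Y) ?_)⟩
  ext Φ
  constructor
  · rintro ⟨_, ⟨z, rfl⟩, rfl⟩
    exact ⟨_, (hcomm z).symm⟩
  · rintro ⟨Ψ, rfl⟩
    obtain ⟨z, rfl⟩ := (dualTensorHomEquiv R (Fin m → R) Y).surjective Ψ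
    exact ⟨_, ⟨z, rfl⟩, hcomm z⟩

end Main

/-- Over a Cohen–Macaulay local ring with canonical module `ω`, a module `M` is maximal
Cohen–Macaulay iff `Tr M ⊗ ω` is maximal Cohen–Macaulay. -/
theorem mcm_iff_transpose_tensor_canonical_mcm (R : Type) [CommRing R] [IsNoetherianRing R]
    [IsLocalRing R] (hCM : IsCMLocal R)
    (ω : Type) [AddCommGroup ω] [Module R ω] (hω : IsCanonicalModule R ω)
    (M T : Type) [AddCommGroup M] [Module R M] [Module.Finite R M]
    [AddCommGroup T] [Module R T]
    (hT : IsAuslanderTranspose R M T) :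
    IsMCM R M ↔ IsMCM R (TensorProduct R T ω) := by
  obtain ⟨d, hd, hY⟩ := hω.isDualizing hCM
  have := hY.finite
  obtain ⟨m, n, f, -, -, ⟨eM⟩, ⟨eT⟩⟩ := hT
  have : Module.Finite R T := Module.Finite.equiv eT
  have hiff : ∀ (X : Type) [AddCommGroup X] [Module R X] [Module.Finite R X],
      IsMCM R X ↔ DepthGE R d X := fun X _ _ _ => ⟨fun h => h.depthGE hd, hY.isMCM hω.2.1⟩
  obtain ⟨e⟩ := nonempty_coker_dualMap_tensor_equiv (Y := ω) f
  have e' := (TensorProduct.congr eT (LinearEquiv.refl R ω)).symm.trans e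
  rw [hiff, hiff]
  exact ⟨fun h => ((hY.depthGE_coker_iff f).1 (h.congr eM.symm)).congr e'.symm,
    fun h => ((hY.depthGE_coker_iff f).2 (h.congr e')).congr eM⟩
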